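/- arXiv:1310.3878 — 2 statements merged into one kernel-verified Lean document; each statement's English description precedes it below -/
import Mathlib

section
/- There is a ℂ(q)-algebra automorphism α of the cyclotomic Hecke algebra H_n(1,0) determined by α(X) = 1 − X and α(T_i) = q − 1 − T_i for 1 ≤ i ≤ n−1; moreover α is an involution (α ∘ α = id), and α(y_(∅,2)) = y_(11,∅) and α(y_(∅,11)) = y_(2,∅). -/
noncomputable section

/-- The relations of the cyclotomic Hecke algebra `H_n(1,0)` on generators
`X, T_1, …, T_{n-1}`, indexed by `Fin n` with `0 ↦ X` and `i ↦ T_i` for `1 ≤ i ≤ n-1`. -/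
inductive CycloRel (K : Type) [Field K] (q : K) (n : ℕ) :
    FreeAlgebra K (Fin n) → FreeAlgebra K (Fin n) → Prop
  | quad (i : Fin n) (hi : 1 ≤ i.val) :
      CycloRel K q n (FreeAlgebra.ι K i * FreeAlgebra.ι K i)
        ((q - 1) • FreeAlgebra.ι K i + q • (1 : FreeAlgebra K (Fin n)))
  | braid (i j : Fin n) (hi : 1 ≤ i.val) (hij : i.val + 1 = j.val) :
      CycloRel K q n (FreeAlgebra.ι K i * FreeAlgebra.ι K j * FreeAlgebra.ι K i)
        (FreeAlgebra.ι K j * FreeAlgebra.ι K i * FreeAlgebra.ι K j)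
  | comm (i j : Fin n) (hi : 1 ≤ i.val) (hj : 1 ≤ j.val)
      (hij : i.val + 2 ≤ j.val ∨ j.val + 2 ≤ i.val) :
      CycloRel K q n (FreeAlgebra.ι K i * FreeAlgebra.ι K j)
        (FreeAlgebra.ι K j * FreeAlgebra.ι K i)
  | Xcomm (x i : Fin n) (hx : x.val = 0) (hi : 2 ≤ i.val) :
      CycloRel K q n (FreeAlgebra.ι K x * FreeAlgebra.ι K i)
        (FreeAlgebra.ι K i * FreeAlgebra.ι K x)
  | Xbraid (x t : Fin n) (hx : x.val = 0) (ht : t.val = 1) :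
      CycloRel K q n
        (FreeAlgebra.ι K x * FreeAlgebra.ι K t * FreeAlgebra.ι K x * FreeAlgebra.ι K t)
        (FreeAlgebra.ι K t * FreeAlgebra.ι K x * FreeAlgebra.ι K t * FreeAlgebra.ι K x)
  | Xidem (x : Fin n) (hx : x.val = 0) :
      CycloRel K q n (FreeAlgebra.ι K x * FreeAlgebra.ι K x) (FreeAlgebra.ι K x)

/-- The cyclotomic Hecke algebra `H_n(1,0)` over `K`. -/
abbrev CycloHecke (K : Type) [Field K] (q : K) (n : ℕ) : Type := RingQuot (CycloRel K q n)

/-- The generators of `H_n(1,0)`: `gen 0 = X`, `gen i = T_i` for `i ≥ 1`. -/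
def CycloHecke.gen {K : Type} [Field K] {q : K} {n : ℕ} (i : Fin n) : CycloHecke K q n :=
  RingQuot.mkAlgHom K (CycloRel K q n) (FreeAlgebra.ι K i)

section Y

local notation "K" => RatFunc ℂ
local notation "q" => (RatFunc.X : RatFunc ℂ)

variable (n : ℕ) (hn : 1 < n)

/-- The generator `X` of `H_n(1,0)` (for `n ≥ 2`). -/
def Xg : CycloHecke K q n := CycloHecke.gen ⟨0, by omega⟩

/-- The generator `T_1` of `H_n(1,0)` (for `n ≥ 2`). -/
def T1g : CycloHecke K q n := CycloHecke.gen ⟨1, hn⟩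

/-- The element `y_(2,∅)` of `H_n(1,0)`. -/
def yTwoEmpty : CycloHecke K q n :=
  (q⁻¹ * (q + 1)⁻¹) • (T1g n hn * Xg n hn * T1g n hn * Xg n hn + Xg n hn * T1g n hn * Xg n hn)

/-- The element `y_(11,∅)` of `H_n(1,0)`. -/
def yElevenEmpty : CycloHecke K q n :=
  (q + 1)⁻¹ • (T1g n hn * Xg n hn * T1g n hn * Xg n hn -
    q • (Xg n hn * T1g n hn * Xg n hn))

/-- The element `y_(∅,2)` of `H_n(1,0)`. -/
def yEmptyTwo : CycloHecke K q n :=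
  (q + 1)⁻¹ • (1 - Xg n hn + T1g n hn - Xg n hn * T1g n hn - T1g n hn * Xg n hn +
    Xg n hn * T1g n hn * Xg n hn - T1g n hn * Xg n hn * T1g n hn +
    Xg n hn * T1g n hn * Xg n hn * T1g n hn)

/-- The element `y_(∅,11)` of `H_n(1,0)`. -/
def yEmptyEleven : CycloHecke K q n :=
  (q + 1)⁻¹ • (q • (1 : CycloHecke K q n) - q • Xg n hn - T1g n hn +
    Xg n hn * T1g n hn + T1g n hn * Xg n hn - Xg n hn * T1g n hn * Xg n hn -
    q⁻¹ • (T1g n hn * Xg n hn * T1g n hn) +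
    q⁻¹ • (Xg n hn * T1g n hn * Xg n hn * T1g n hn))

end Y

namespace CycloHecke

section Identities

variable {R A : Type*} [CommRing R] [Ring A] [Algebra R A] {r : R} {a b x t : A}

theorem quad_sub (ha : a * a = (r - 1) • a + r • (1 : A)) :
    ((r - 1) • (1 : A) - a) * ((r - 1) • (1 : A) - a) =
      (r - 1) • ((r - 1) • (1 : A) - a) + r • (1 : A) := by
  simp only [mul_sub, sub_mul, smul_mul_assoc, mul_smul_comm, mul_one, one_mul, ha]
  module

theorem braid_sub (ha : a * a = (r - 1) • a + r • (1 : A))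
    (hb : b * b = (r - 1) • b + r • (1 : A)) (hab : a * b * a = b * a * b) :
    ((r - 1) • (1 : A) - a) * ((r - 1) • (1 : A) - b) * ((r - 1) • (1 : A) - a) =
      ((r - 1) • (1 : A) - b) * ((r - 1) • (1 : A) - a) * ((r - 1) • (1 : A) - b) := by
  simp only [mul_sub, sub_mul, smul_mul_assoc, mul_smul_comm, mul_one, one_mul, ha, hb, hab]
  module

theorem comm_sub (hab : a * b = b * a) (c d : R) :
    (c • (1 : A) - a) * (d • (1 : A) - b) = (d • (1 : A) - b) * (c • (1 : A) - a) := by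
  simp only [mul_sub, sub_mul, smul_mul_assoc, mul_smul_comm, mul_one, one_mul, hab]
  module

theorem mixed_braid_sub (ht : t * t = (r - 1) • t + r • (1 : A))
    (hxx : x * x = x) (hxt : x * t * x * t = t * x * t * x) :
    (1 - x) * ((r - 1) • (1 : A) - t) * (1 - x) * ((r - 1) • (1 : A) - t) =
      ((r - 1) • (1 : A) - t) * (1 - x) * ((r - 1) • (1 : A) - t) * (1 - x) := by
  simp only [mul_assoc] at hxt
  simp only [mul_sub, sub_mul, mul_add, add_mul, smul_mul_assoc, mul_smul_comm, mul_one, one_mul,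
    mul_assoc, ht, hxx, hxt]
  module

theorem symmetrizer_sub (ht : t * t = (r - 1) • t + r • (1 : A))
    (hxx : x * x = x) (hxt : x * t * x * t = t * x * t * x) :
    1 - (1 - x) + ((r - 1) • (1 : A) - t) - (1 - x) * ((r - 1) • (1 : A) - t) -
        ((r - 1) • (1 : A) - t) * (1 - x) + (1 - x) * ((r - 1) • (1 : A) - t) * (1 - x) -
        ((r - 1) • (1 : A) - t) * (1 - x) * ((r - 1) • (1 : A) - t) +
        (1 - x) * ((r - 1) • (1 : A) - t) * (1 - x) * ((r - 1) • (1 : A) - t) =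
      t * x * t * x - r • (x * t * x) := by
  simp only [mul_assoc] at hxt
  simp only [mul_sub, sub_mul, mul_add, smul_mul_assoc, mul_smul_comm, mul_one, one_mul,
    mul_assoc, ht, hxx, hxt]
  module

theorem antisymmetrizer_sub {s : R} (hs : s * r = 1) (ht : t * t = (r - 1) • t + r • (1 : A))
    (hxx : x * x = x) (hxt : x * t * x * t = t * x * t * x) :
    r • (1 : A) - r • (1 - x) - ((r - 1) • (1 : A) - t) +
        (1 - x) * ((r - 1) • (1 : A) - t) + ((r - 1) • (1 : A) - t) * (1 - x) -
        (1 - x) * ((r - 1) • (1 : A) - t) * (1 - x) -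
        s • (((r - 1) • (1 : A) - t) * (1 - x) * ((r - 1) • (1 : A) - t)) +
        s • ((1 - x) * ((r - 1) • (1 : A) - t) * (1 - x) * ((r - 1) • (1 : A) - t)) =
      s • (t * x * t * x + x * t * x) := by
  simp only [mul_assoc] at hxt
  simp only [mul_sub, sub_mul, mul_add, smul_mul_assoc, mul_smul_comm, mul_one, one_mul,
    mul_assoc, ht, hxx, hxt]
  match_scalars <;> grind

end Identities

section Involution

variable {F : Type} [Field F] {p : F} {n : ℕ}

theorem gen_quad (i : Fin n) (hi : 1 ≤ i.val) :
    (gen i : CycloHecke F p n) * gen i = (p - 1) • gen i + p • (1 : CycloHecke F p n) := by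
  simpa [gen] using RingQuot.mkAlgHom_rel F (CycloRel.quad (K := F) (q := p) i hi)

theorem gen_braid (i j : Fin n) (hi : 1 ≤ i.val) (hij : i.val + 1 = j.val) :
    (gen i : CycloHecke F p n) * gen j * gen i = gen j * gen i * gen j := by
  simpa [gen] using RingQuot.mkAlgHom_rel F (CycloRel.braid (K := F) (q := p) i j hi hij)

theorem gen_comm (i j : Fin n) (hi : 1 ≤ i.val) (hj : 1 ≤ j.val)
    (hij : i.val + 2 ≤ j.val ∨ j.val + 2 ≤ i.val) :
    (gen i : CycloHecke F p n) * gen j = gen j * gen i := by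
  simpa [gen] using RingQuot.mkAlgHom_rel F (CycloRel.comm (K := F) (q := p) i j hi hj hij)

theorem gen_zero_comm (x i : Fin n) (hx : x.val = 0) (hi : 2 ≤ i.val) :
    (gen x : CycloHecke F p n) * gen i = gen i * gen x := by
  simpa [gen] using RingQuot.mkAlgHom_rel F (CycloRel.Xcomm (K := F) (q := p) x i hx hi)

theorem gen_zero_braid (x t : Fin n) (hx : x.val = 0) (ht : t.val = 1) :
    (gen x : CycloHecke F p n) * gen t * gen x * gen t = gen t * gen x * gen t * gen x := by
  simpa [gen] using RingQuot.mkAlgHom_rel F (CycloRel.Xbraid (K := F) (q := p) x t hx ht)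

theorem gen_zero_idem (x : Fin n) (hx : x.val = 0) :
    (gen x : CycloHecke F p n) * gen x = gen x := by
  simpa [gen] using RingQuot.mkAlgHom_rel F (CycloRel.Xidem (K := F) (q := p) x hx)

theorem algHom_ext {B : Type*} [Semiring B] [Algebra F B] {f g : CycloHecke F p n →ₐ[F] B}
    (h : ∀ i, f (gen i) = g (gen i)) : f = g :=
  RingQuot.ringQuot_ext' F _ _ (FreeAlgebra.hom_ext (funext h))

/-- The image of a generator under the involution: `X ↦ 1 - X` and `T_i ↦ q - 1 - T_i`. -/
def invGen (i : Fin n) : CycloHecke F p n :=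
  (if i.val = 0 then (1 : F) else p - 1) • (1 : CycloHecke F p n) - gen i

theorem invGen_zero {i : Fin n} (hi : i.val = 0) :
    (invGen i : CycloHecke F p n) = 1 - gen i := by
  simp [invGen, hi]

theorem invGen_pos {i : Fin n} (hi : 1 ≤ i.val) :
    (invGen i : CycloHecke F p n) = (p - 1) • (1 : CycloHecke F p n) - gen i := by
  simp [invGen, Nat.one_le_iff_ne_zero.mp hi]

theorem lift_invGen_rel ⦃a b : FreeAlgebra F (Fin n)⦄ (h : CycloRel F p n a b) :
    FreeAlgebra.lift F (invGen : Fin n → CycloHecke F p n) a =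
      FreeAlgebra.lift F (invGen : Fin n → CycloHecke F p n) b := by
  induction h with
  | quad i hi =>
    simpa [invGen_pos hi] using quad_sub (gen_quad i hi)
  | braid i j hi hij =>
    have hj : 1 ≤ j.val := by omega
    simpa only [map_mul, FreeAlgebra.lift_ι_apply, invGen_pos hi, invGen_pos hj] using
      braid_sub (gen_quad i hi) (gen_quad j hj) (gen_braid i j hi hij)
  | comm i j hi hj hij =>
    simp only [map_mul, FreeAlgebra.lift_ι_apply]
    exact comm_sub (gen_comm i j hi hj hij) _ _
  | Xcomm x i hx hi =>
    simp only [map_mul, FreeAlgebra.lift_ι_apply]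
    exact comm_sub (gen_zero_comm x i hx hi) _ _
  | Xbraid x t hx ht =>
    have ht' : 1 ≤ t.val := ht.ge
    simpa only [map_mul, FreeAlgebra.lift_ι_apply, invGen_zero hx, invGen_pos ht'] using
      mixed_braid_sub (gen_quad t ht') (gen_zero_idem x hx) (gen_zero_braid x t hx ht)
  | Xidem x hx =>
    simp [invGen_zero hx, mul_sub, sub_mul, gen_zero_idem x hx]

/-- The endomorphism of `H_n(1,0)` with `X ↦ 1 - X` and `T_i ↦ q - 1 - T_i`. -/
def involutionHom : CycloHecke F p n →ₐ[F] CycloHecke F p n :=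
  RingQuot.liftAlgHom F ⟨FreeAlgebra.lift F invGen, lift_invGen_rel⟩

theorem involutionHom_gen (i : Fin n) :
    involutionHom (gen i : CycloHecke F p n) = invGen i := by
  simp [involutionHom, gen]

theorem involutionHom_comp_self :
    (involutionHom : CycloHecke F p n →ₐ[F] _).comp involutionHom = AlgHom.id F _ :=
  algHom_ext fun i => by
    simp only [AlgHom.comp_apply, involutionHom_gen, AlgHom.id_apply]
    rw [invGen, map_sub, map_smul, map_one, involutionHom_gen, invGen, sub_sub_cancel]

/-- The involutive automorphism of `H_n(1,0)` with `X ↦ 1 - X` and `T_i ↦ q - 1 - T_i`. -/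
def involution : CycloHecke F p n ≃ₐ[F] CycloHecke F p n :=
  AlgEquiv.ofAlgHom involutionHom involutionHom involutionHom_comp_self involutionHom_comp_self

theorem involution_gen (i : Fin n) : involution (gen i : CycloHecke F p n) = invGen i :=
  involutionHom_gen i

end Involution

end CycloHecke

section Stmt8

local notation "K" => RatFunc ℂ
local notation "q" => (RatFunc.X : RatFunc ℂ)

/-- There is a (unique) `ℂ(q)`-algebra automorphism `α` of `H_n(1,0)`
with `α(X) = 1 − X` and `α(T_i) = q − 1 − T_i`; it is an involution and satisfies
`α(y_(∅,2)) = y_(11,∅)` and `α(y_(∅,11)) = y_(2,∅)`. -/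
theorem cycloHecke_exists_involution (n : ℕ) (hn : 1 < n) :
    ∃ α : CycloHecke K q n ≃ₐ[K] CycloHecke K q n,
      α (Xg n hn) = 1 - Xg n hn ∧
      (∀ i : Fin n, 1 ≤ i.val →
        α (CycloHecke.gen i) = (q - 1) • (1 : CycloHecke K q n) - CycloHecke.gen i) ∧
      (∀ β : CycloHecke K q n ≃ₐ[K] CycloHecke K q n,
        (β (Xg n hn) = 1 - Xg n hn ∧ ∀ i : Fin n, 1 ≤ i.val →
          β (CycloHecke.gen i) = (q - 1) • (1 : CycloHecke K q n) - CycloHecke.gen i) →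
        β = α) ∧
      α.trans α = AlgEquiv.refl ∧
      α (yEmptyTwo n hn) = yElevenEmpty n hn ∧
      α (yEmptyEleven n hn) = yTwoEmpty n hn := by
  have hX : CycloHecke.involution (Xg n hn) = 1 - Xg n hn :=
    (CycloHecke.involution_gen _).trans (CycloHecke.invGen_zero rfl)
  have hT : CycloHecke.involution (T1g n hn) = (q - 1) • (1 : CycloHecke K q n) - T1g n hn :=
    (CycloHecke.involution_gen _).trans (CycloHecke.invGen_pos le_rfl)
  have hq : (q : K) ≠ 0 := RatFunc.X_ne_zero
  have hxx : Xg n hn * Xg n hn = Xg n hn := CycloHecke.gen_zero_idem _ rfl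
  have ht : T1g n hn * T1g n hn = (q - 1) • T1g n hn + q • (1 : CycloHecke K q n) :=
    CycloHecke.gen_quad _ le_rfl
  have hxt : Xg n hn * T1g n hn * Xg n hn * T1g n hn =
      T1g n hn * Xg n hn * T1g n hn * Xg n hn :=
    CycloHecke.gen_zero_braid _ _ rfl rfl
  refine ⟨CycloHecke.involution, hX, fun i hi => ?_, fun β ⟨hβX, hβT⟩ => ?_, ?_, ?_, ?_⟩
  · rw [CycloHecke.involution_gen, CycloHecke.invGen_pos hi]
  · refine AlgEquiv.coe_toAlgHom_injective (CycloHecke.algHom_ext fun i => ?_)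
    rcases Nat.eq_zero_or_pos i.val with hi | hi
    · have hi' : i = ⟨0, by omega⟩ := Fin.ext hi
      rw [hi']
      exact hβX.trans hX.symm
    · exact (hβT i hi).trans
        ((CycloHecke.involution_gen i).trans (CycloHecke.invGen_pos hi)).symm
  · exact AlgEquiv.ext fun a => DFunLike.congr_fun CycloHecke.involutionHom_comp_self a
  · simp only [yEmptyTwo, yElevenEmpty, map_smul, map_sub, map_add, map_mul, map_one, hX, hT]
    rw [CycloHecke.symmetrizer_sub ht hxx hxt]
  · simp only [yEmptyEleven, yTwoEmpty, map_smul, map_sub, map_add, map_mul, map_one, hX, hT]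
    rw [CycloHecke.antisymmetrizer_sub (inv_mul_cancel₀ hq) ht hxx hxt, smul_smul, mul_comm]

end Stmt8
end
end

section
/- Over ℂ(q), the four quotients of the cyclotomic Hecke algebra H_n(1,0) by the two-sided ideals generated respectively by y_(∅,2), y_(∅,11), y_(2,∅), y_(11,∅) are pairwise isomorphic as ℂ(q)-algebras; in particular the generic mirabolic Hecke algebra ℛ_n ≅ H_n(1,0)/(y_(∅,2)) is isomorphic to the generic q-rook algebra 𝕀_n ≅ H_n(1,0)/(y_(∅,11)). -/
noncomputable section

section Y

local notation "K" => RatFunc ℂ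
local notation "q" => (RatFunc.X : RatFunc ℂ)

variable (n : ℕ) (hn : 1 < n)

end Y

/-- The relations of Solomon's presentation of the mirabolic Hecke algebra `R_n(K,q)`,
on generators `T_0, T_1, …, T_{n-1}` (indexed by `Fin n`). -/
inductive SolomonRel (K : Type) [Field K] (q : K) (n : ℕ) :
    FreeAlgebra K (Fin n) → FreeAlgebra K (Fin n) → Prop
  | quad0 (i : Fin n) (hi : i.val = 0) :
      SolomonRel K q n (FreeAlgebra.ι K i * FreeAlgebra.ι K i)
        ((q - 2) • FreeAlgebra.ι K i + (q - 1) • (1 : FreeAlgebra K (Fin n)))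
  | quad (i : Fin n) (hi : 1 ≤ i.val) :
      SolomonRel K q n (FreeAlgebra.ι K i * FreeAlgebra.ι K i)
        ((q - 1) • FreeAlgebra.ι K i + q • (1 : FreeAlgebra K (Fin n)))
  | braid (i j : Fin n) (hi : 1 ≤ i.val) (hij : i.val + 1 = j.val) :
      SolomonRel K q n (FreeAlgebra.ι K i * FreeAlgebra.ι K j * FreeAlgebra.ι K i)
        (FreeAlgebra.ι K j * FreeAlgebra.ι K i * FreeAlgebra.ι K j)
  | rel4 (i j : Fin n) (hi : i.val = 0) (hj : j.val = 1) :
      SolomonRel K q n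
        (FreeAlgebra.ι K i * FreeAlgebra.ι K j * FreeAlgebra.ι K i * FreeAlgebra.ι K j)
        ((q - 1) • (FreeAlgebra.ι K j * FreeAlgebra.ι K i * FreeAlgebra.ι K j +
            FreeAlgebra.ι K j * FreeAlgebra.ι K i) -
          FreeAlgebra.ι K i * FreeAlgebra.ι K j * FreeAlgebra.ι K i)
  | rel5 (i j : Fin n) (hi : i.val = 0) (hj : j.val = 1) :
      SolomonRel K q n
        (FreeAlgebra.ι K j * FreeAlgebra.ι K i * FreeAlgebra.ι K j * FreeAlgebra.ι K i)
        ((q - 1) • (FreeAlgebra.ι K j * FreeAlgebra.ι K i * FreeAlgebra.ι K j +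
            FreeAlgebra.ι K i * FreeAlgebra.ι K j) -
          FreeAlgebra.ι K i * FreeAlgebra.ι K j * FreeAlgebra.ι K i)
  | comm (i j : Fin n) (hij : i.val + 2 ≤ j.val ∨ j.val + 2 ≤ i.val) :
      SolomonRel K q n (FreeAlgebra.ι K i * FreeAlgebra.ι K j)
        (FreeAlgebra.ι K j * FreeAlgebra.ι K i)

/-- The mirabolic Hecke algebra `R_n(K,q)`, presented by Solomon's relations. -/
abbrev MirabolicHecke (K : Type) [Field K] (q : K) (n : ℕ) : Type :=
  RingQuot (SolomonRel K q n)

/-- The generator `T_i` of the mirabolic Hecke algebra. -/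
def MirabolicHecke.T {K : Type} [Field K] {q : K} {n : ℕ} (i : Fin n) :
    MirabolicHecke K q n :=
  RingQuot.mkAlgHom K (SolomonRel K q n) (FreeAlgebra.ι K i)


section Stmt10

local notation "K" => RatFunc ℂ
local notation "q" => (RatFunc.X : RatFunc ℂ)

variable (n : ℕ) (hn : 1 < n)

/-- The quotient of `H_n(1,0)` by the two-sided ideal generated by an element `y`,
realized as a `RingQuot` by the relation `y = 0`. -/
abbrev CycloQuot (y : CycloHecke K q n) : Type :=
  RingQuot (fun a b : CycloHecke K q n => a = y ∧ b = 0)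

end Stmt10

/-- `IsSupport a p`: `p` is the support projection of a group-invertible element `a`. -/
def IsSupport {A : Type*} [Ring A] (a p : A) : Prop :=
  ∃ g, a * g = p ∧ g * a = p ∧ a * p = a ∧ p * a = a ∧ g * p = g ∧ p * g = g

namespace IsSupport

variable {A B : Type*} [Ring A] [Ring B] {a p p' x : A}

theorem of_eq_sq_mul {x y : A} (hx : a * a * x = a) (hy : y * (a * a) = a) :
    IsSupport a (a * x) := by
  have hyx : y * a = a * x := by
    calc y * a = y * (a * a * x) := by rw [hx]
      _ = y * (a * a) * x := by noncomm_ring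
      _ = a * x := by rw [hy]
  have h1 : a * (a * x) = a := by rw [← mul_assoc, hx]
  have h2 : a * x * a = a := by rw [← hyx, mul_assoc, hy]
  have h3 : a * x * (a * x) = a * x := by rw [← mul_assoc, h2]
  refine ⟨a * x * x, ?_, ?_, h1, h2, ?_, ?_⟩
  · rw [mul_assoc a x x, ← mul_assoc, ← mul_assoc, hx]
  · calc a * x * x * a = y * a * x * a := by rw [hyx]
      _ = y * (a * x * a) := by noncomm_ring
      _ = a * x := by rw [h2, hyx]
  · calc a * x * x * (a * x) = (a * x) * x * (a * x) := by noncomm_ring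
      _ = y * a * x * (a * x) := by rw [hyx]
      _ = y * (a * x * (a * x)) := by noncomm_ring
      _ = y * a * x := by rw [h3]; noncomm_ring
      _ = a * x * x := by rw [hyx]
  · rw [← mul_assoc, h3]

theorem mul_self (h : IsSupport a p) : p * p = p := by
  obtain ⟨g, h1, h2, h3, h4, -, -⟩ := h
  calc p * p = g * (a * p) := by rw [← mul_assoc, h2]
    _ = p := by rw [h3, h2]

theorem commute (h : IsSupport a p) (hx : Commute x a) : Commute x p := by
  obtain ⟨g, h1, h2, h3, h4, -, -⟩ := h
  have e1 : p * x = p * x * p := by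
    calc p * x = g * (a * x) := by rw [← mul_assoc, h2]
      _ = g * (x * (a * p)) := by rw [h3, hx.eq]
      _ = g * (a * x) * p := by rw [← hx.eq]; noncomm_ring
      _ = p * x * p := by rw [← mul_assoc, h2]
  have e2 : x * p = p * x * p := by
    calc x * p = x * a * g := by rw [mul_assoc, h1]
      _ = (p * a) * x * g := by rw [h4, hx.eq]
      _ = p * (x * a) * g := by rw [hx.eq]; noncomm_ring
      _ = p * x * p := by rw [← h1]; noncomm_ring
  exact e2.trans e1.symm

theorem unique (h : IsSupport a p) (h' : IsSupport a p') : p = p' := by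
  obtain ⟨g, h1, h2, h3, h4, -, -⟩ := h
  obtain ⟨g', h1', h2', h3', h4', -, -⟩ := h'
  calc p = g * (a * p') := by rw [h3', h2]
    _ = p * a * g' := by rw [← h1', ← h2]; noncomm_ring
    _ = p' := by rw [h4, h1']

theorem map {F : Type*} [FunLike F A B] [RingHomClass F A B] (f : F) (h : IsSupport a p) :
    IsSupport (f a) (f p) := by
  obtain ⟨g, h1, h2, h3, h4, h5, h6⟩ := h
  exact ⟨f g, by rw [← map_mul, h1], by rw [← map_mul, h2], by rw [← map_mul, h3],
    by rw [← map_mul, h4], by rw [← map_mul, h5], by rw [← map_mul, h6]⟩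

end IsSupport

section Hecke

variable {K A : Type*} [Field K] [Ring A] [Algebra K A] {q c : K} {a b p r S T : A}

theorem exists_sq_mul_eq {g : A} (hq : q ≠ 0) (hT : T = S + c • (1 : A)) (hST : S * T = q • (1 : A))
    (hTa : T * a = b * S) (hag : a * g = p) (hga : g * a = p) (hap : a * p = a)
    (hgp : g * p = g) (hab : Commute a b)
    (hgb : Commute g b) : ∃ x, b * b * x = b := by
  have hbT : b * T = T * a + c • b := by rw [hTa, hT]; simp [mul_add]
  have hbp : b * p = p * b := by
    rw [← hag]; exact (hab.mul_left hgb).symm.eq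
  have hpp : p * p = p := by nth_rw 1 [← hga]; rw [mul_assoc, hap, hga]
  have hSS : S * S = q • (1 : A) - c • S := by
    rw [← hST, hT]; simp [mul_add]
  have hTaT : T * a * T = q • b := by rw [hTa, mul_assoc, hST]; simp
  have e1 : b * b * (S * g * S) = q • b - c • (b * S) + c • (b * p * S) := by
    calc b * b * (S * g * S) = b * (b * S) * g * S := by noncomm_ring
      _ = b * T * (a * g) * S := by rw [← hTa]; noncomm_ring
      _ = T * (a * p) * S + c • (b * p * S) := by rw [hbT, hag]; simp [add_mul, mul_assoc]
      _ = b * (S * S) + c • (b * p * S) := by rw [hap, hTa]; noncomm_ring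
      _ = _ := by rw [hSS]; simp [mul_sub]
  have hbT' : b * T * (1 - p) = c • (b * (1 - p)) := by
    have : a * (1 - p) = 0 := by rw [mul_sub, hap, mul_one, sub_self]
    rw [hbT, add_mul, mul_assoc, this, mul_zero, zero_add, smul_mul_assoc]
  have hz (y : A) (hy : b * y = y * b) (hyp : y * (1 - p) = 0) : b * y * T * (1 - p) = 0 := by
    calc b * y * T * (1 - p) = y * (b * T * (1 - p)) := by rw [hy]; noncomm_ring
      _ = c • (b * (y * (1 - p))) := by
        rw [hbT', mul_smul_comm, ← mul_assoc, ← hy, mul_assoc]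
      _ = 0 := by rw [hyp]; simp
  have e2 : b * b * (T * g * T * (1 - p) * S) = q • (b * (1 - p) * S) := by
    calc b * b * (T * g * T * (1 - p) * S) = b * (b * T) * g * T * (1 - p) * S := by noncomm_ring
      _ = b * (T * (a * g)) * T * (1 - p) * S + c • (b * (b * g * T * (1 - p)) * S) := by
        rw [hbT]; simp only [add_mul, mul_add, mul_assoc, smul_mul_assoc, mul_smul_comm]
      _ = T * (a * p) * T * (1 - p) * S + c • (b * p * T * (1 - p) * S) := by
        rw [hz g hgb.symm (by rw [mul_sub, hgp, mul_one, sub_self]), hag, ← mul_assoc b T, hbT]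
        simp only [add_mul, mul_assoc, smul_mul_assoc, mul_zero, zero_mul, smul_zero, add_zero]
      _ = q • (b * (1 - p) * S) := by
        rw [hap, hTaT, hz p hbp (by rw [mul_sub, hpp, mul_one, sub_self])]
        simp only [zero_mul, smul_zero, add_zero, smul_mul_assoc]
  refine ⟨q⁻¹ • (S * g * S) + (c / q ^ 2) • (T * g * T * (1 - p) * S), ?_⟩
  rw [mul_add, mul_smul_comm, mul_smul_comm, e1, e2]
  simp only [mul_sub, sub_mul, mul_one]
  match_scalars <;> field_simp <;> ring

theorem IsSupport.exists_of_intertwine (hq : q ≠ 0) (hT : T = S + c • (1 : A))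
    (hST : S * T = q • (1 : A)) (hTa : T * a = b * S) (haT : a * T = S * b) (hab : Commute a b)
    (h : IsSupport a p) : ∃ r, IsSupport b r := by
  have hg := h
  obtain ⟨g, h1, h2, h3, h4, h5, h6⟩ := hg
  have hpb : p * b = b * p := (h.commute hab.symm).symm.eq
  have hgb : Commute g b := by
    calc g * b = g * p * b := by rw [h5]
      _ = g * (b * a) * g := by rw [mul_assoc, hpb, ← h1]; noncomm_ring
      _ = p * b * g := by rw [← hab.eq, ← mul_assoc, h2]
      _ = b * g := by rw [hpb, mul_assoc, h6]
  have hTS : T * S = q • (1 : A) := by rw [← hST, hT]; simp [mul_add, add_mul]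
  obtain ⟨x, hx⟩ := exists_sq_mul_eq hq hT hST hTa h1 h2 h3 h5 hab hgb
  obtain ⟨y, hy⟩ := exists_sq_mul_eq (A := Aᵐᵒᵖ) (q := q) (c := c) (a := .op a) (b := .op b)
    (p := .op p) (S := .op S) (T := .op T) (g := .op g) hq (by rw [hT]; rfl)
    (by rw [← MulOpposite.op_mul, hTS]; rfl) (by rw [← MulOpposite.op_mul, haT]; rfl)
    (by rw [← MulOpposite.op_mul, h2]) (by rw [← MulOpposite.op_mul, h1])
    (by rw [← MulOpposite.op_mul, h4]) (by rw [← MulOpposite.op_mul, h6]) hab.op hgb.op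
  exact ⟨_, .of_eq_sq_mul hx (y := y.unop) (by simpa using congrArg MulOpposite.unop hy)⟩

theorem IsSupport.mul_intertwine (hT : T = S + c • (1 : A))
    (haT : a * T = S * b) (ha : IsSupport a p) (hb : IsSupport b r) :
    p * T = T * r - c • ((1 - p) * r) := by
  obtain ⟨g, -, g2, -, g4, -, -⟩ := ha
  obtain ⟨k, k1, -, k3, -, -, -⟩ := hb
  have e1 : p * T = p * T * r := by
    rw [← g2, mul_assoc g, haT]; simp only [mul_assoc, k3]
  have e2 : S * r = p * (S * r) := by
    rw [← k1, ← mul_assoc S, ← haT]; simp only [← mul_assoc, g4]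
  have e3 : p * (T * r) = S * r + c • (p * r) := by
    rw [hT, add_mul, mul_add, ← e2]; simp
  rw [e1, mul_assoc, e3, hT]
  simp only [add_mul, sub_mul, one_mul, smul_mul_assoc]
  module

theorem IsSupport.mul_intertwine' (hT : T = S + c • (1 : A)) (hTa : T * a = b * S)
    (hab : Commute a b) (ha : IsSupport a p) (hb : IsSupport b r) :
    r * T = T * p + c • ((1 - p) * r) := by
  have hpr : r * p = p * r := (ha.commute (hb.commute hab).symm).eq
  obtain ⟨g, g1, -, g3, -, -, -⟩ := ha
  obtain ⟨k, -, k2, -, k4, -, -⟩ := hb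
  have e1 : T * p = r * T * p := by
    rw [← g1, ← mul_assoc, mul_assoc r T, ← mul_assoc T, hTa]; simp only [← mul_assoc, k4]
  have e2 : r * S = r * S * p := by
    rw [← k2, mul_assoc, ← hTa]; simp only [mul_assoc, g3]
  rw [e1, hT]
  simp only [add_mul, mul_add, sub_mul, one_mul, smul_mul_assoc, mul_smul_comm, mul_one, hpr, ← e2]
  module

end Hecke

section Twist

variable {K A : Type*} [Field K] [Ring A] [Algebra K A] {q c : K}

/-- The generator `T` twisted by `T ↦ c - T` on the image of the idempotent `f`. -/
def twist (c : K) (f T : A) : A := T + f * (c • 1 - 2 * T)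

theorem twist_braid_of_intertwine {T U e f h g : A} (hT : T * T = c • T + q • 1)
    (hU : U * U = c • U + q • 1) (hTU : T * (U * T) = U * (T * U))
    (hee : e * e = e) (hef : e * f = g) (hfe : f * e = g)
    (heT : e * T = T * e) (hfT : f * T = T * h - c • h + c • g)
    (hhT : h * T = T * f + c • h - c • g)
    (hgT : g * T = T * g) (heU : e * U = U * h + c • e - c • g) (hfU : f * U = U * f)
    (hhU : h * U = U * e - c • e + c • g) (hgU : g * U = U * g)
    (hge : g * e = g) (hgf : g * f = g) (hhe : h * e = g) (hhf : h * f = g) :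
    twist c e T * twist c f U * twist c e T = twist c f U * twist c e T * twist c f U := by
  have ext {a b : A} (h : a = b) (w : A) : a * w = b * w := by rw [h]
  have eT := ext hT
  have eU := ext hU
  have eTU := ext hTU
  simp only [mul_assoc, add_mul, smul_mul_assoc, one_mul] at eT eU eTU
  have hE : twist c e T = T + c • e - (2 : K) • (T * e) := by
    simp only [twist, mul_sub, mul_smul_comm, mul_one, two_mul, mul_add, heT]; module
  have hF : twist c f U = U + c • f - (2 : K) • (U * f) := by
    simp only [twist, mul_sub, mul_smul_comm, mul_one, two_mul, mul_add, hfU]; module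
  have eeT := ext heT
  have efT := ext hfT
  have ehT := ext hhT
  have egT := ext hgT
  have eeU := ext heU
  have ehU := ext hhU
  have egU := ext hgU
  simp only [mul_assoc, add_mul, sub_mul, smul_mul_assoc] at eeT efT ehT egT eeU ehU egU
  rw [hE, hF]
  simp only [mul_assoc, add_mul, sub_mul, mul_add, mul_sub, smul_mul_assoc, mul_smul_comm,
    hTU, hee, hef, hfe, heT, hfT, hhT, hgT, heU, hhU, hgU, hge, hgf,
    hhe, hhf, eT, eU, eTU, eeT, efT, ehT, egT, eeU, ehU, egU]
  module

theorem twist_braid {T U x y z : A} (hT : T * T = c • T + q • 1) (hU : U * U = c • U + q • 1)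
    (hTU : T * U * T = U * T * U) (hx : x * x = x) (hy : y * y = y) (hz : z * z = z)
    (hxy : Commute x y) (hxz : Commute x z) (hyz : Commute y z)
    (hxT : x * T = T * y + c • (x * (1 - y))) (hyT : y * T = T * x - c • (x * (1 - y)))
    (hzT : Commute z T) (hyU : y * U = U * z + c • (y * (1 - z)))
    (hzU : z * U = U * y - c • (y * (1 - z))) (hxU : Commute x U) :
    twist c (x * y) T * twist c (y * z) U * twist c (x * y) T =
      twist c (y * z) U * twist c (x * y) T * twist c (y * z) U := by
  have ext {a b : A} (h : a = b) (w : A) : a * w = b * w := by rw [h]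
  have ex := ext hx
  have ey := ext hy
  have exy := ext hxy.symm.eq
  have exz := ext hxz.symm.eq
  have eyz := ext hyz.symm.eq
  have exT := ext hxT
  have eyT := ext hyT
  have eyU := ext hyU
  have exU := ext hxU.eq
  simp only [mul_assoc, add_mul, sub_mul, mul_sub, smul_mul_assoc, mul_one]
    at ex ey exy exz eyz exT eyT eyU exU
  apply twist_braid_of_intertwine (h := x * z) (g := x * (y * z)) hT hU
    (by simpa only [mul_assoc] using hTU)
  all_goals
    simp only [mul_assoc, mul_add, mul_sub, mul_smul_comm, mul_one, hx, hy, hz, hxy.symm.eq,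
      hyz.symm.eq, hyT, hzT.eq, hyU, hzU, ex, ey, exy, exz, eyz, exT, eyT, eyU, exU]
  all_goals module

theorem twist_mul_self {T f : A} (hT : T * T = c • T + q • 1) (hf : f * f = f)
    (hfT : Commute f T) : twist c f T * twist c f T = c • twist c f T + q • 1 := by
  have ext {a b : A} (h : a = b) (w : A) : a * w = b * w := by rw [h]
  have eT := ext hT
  have efT := ext hfT.eq
  simp only [mul_assoc, add_mul, smul_mul_assoc, one_mul] at eT efT
  simp only [twist, two_mul, mul_assoc, mul_add, mul_sub, add_mul, sub_mul, mul_smul_comm,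
    smul_mul_assoc, mul_one, hfT.eq, hT, hf, eT, efT]
  module

theorem twist_twist {T f : A} (hf : f * f = f) : twist c f (twist c f T) = T := by
  have ef (w : A) : f * (f * w) = f * w := by rw [← mul_assoc, hf]
  simp only [twist, two_mul, mul_add, mul_sub, mul_smul_comm, mul_one, ef, hf]
  module

theorem map_twist {B : Type*} [Ring B] [Algebra K B] (φ : A →ₐ[K] B) (f T : A) :
    φ (twist c f T) = twist c (φ f) (φ T) := by
  simp [twist, two_mul]

theorem Commute.twist_right {w f T : A} (hf : Commute w f) (hT : Commute w T) :
    Commute w (twist c f T) :=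
  hT.add_right (hf.mul_right
    (((Commute.one_right w).smul_right c).sub_right ((Commute.ofNat_right w 2).mul_right hT)))

end Twist

/-- The defining relations of `H_n(1,0)` for a sequence `X = G 0`, `T_i = G i` (`1 ≤ i < n`). -/
structure IsCycloFamily {K A : Type*} [Field K] [Ring A] [Algebra K A] (q : K) (n : ℕ)
    (G : ℕ → A) : Prop where
  quad : ∀ i, 1 ≤ i → i < n → G i * G i = (q - 1) • G i + q • 1
  braid : ∀ i, 1 ≤ i → i + 1 < n → G i * G (i + 1) * G i = G (i + 1) * G i * G (i + 1)
  comm : ∀ i j, i + 2 ≤ j → j < n → Commute (G i) (G j)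
  braid_zero : 1 < n → G 0 * G 1 * G 0 * G 1 = G 1 * G 0 * G 1 * G 0
  idem : 0 < n → G 0 * G 0 = G 0

section JucysMurphy

variable {K A : Type*} [Field K] [Ring A] [Algebra K A]

/-- The Jucys–Murphy elements `q^{-k} T_k ⋯ T_1 X T_1 ⋯ T_k`. -/
def jucysMurphy (q : K) (G : ℕ → A) : ℕ → A
  | 0 => G 0
  | k + 1 => q⁻¹ • (G (k + 1) * jucysMurphy q G k * G (k + 1))

open Classical in
/-- The projection onto the kernel of the `k`-th Jucys–Murphy element along its image. -/
def kerProj (q : K) (G : ℕ → A) (k : ℕ) : A :=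
  if h : ∃ p, IsSupport (jucysMurphy q G k) p then 1 - h.choose else 0

/-- The family obtained by twisting each `T_k` on the common kernel of the two Jucys–Murphy
elements it intertwines. -/
def twistFamily (q : K) (G : ℕ → A) : ℕ → A
  | 0 => G 0
  | k + 1 => twist (q - 1) (kerProj q G k * kerProj q G (k + 1)) (G (k + 1))

namespace IsCycloFamily

variable {q : K} {n : ℕ} {G : ℕ → A}

theorem map {B : Type*} [Ring B] [Algebra K B] (hG : IsCycloFamily q n G) (φ : A →ₐ[K] B) :
    IsCycloFamily q n fun k => φ (G k) where
  quad i h hi := by simpa using congrArg φ (hG.quad i h hi)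
  braid i h hi := by simpa using congrArg φ (hG.braid i h hi)
  comm i j h hj := (hG.comm i j h hj).map φ
  braid_zero hn := by simpa using congrArg φ (hG.braid_zero hn)
  idem hn := by simpa using congrArg φ (hG.idem hn)

theorem commute_jucysMurphy_of_lt (hG : IsCycloFamily q n G) {i : ℕ} (hi : i < n) :
    ∀ {k : ℕ}, k + 2 ≤ i → Commute (G i) (jucysMurphy q G k)
  | 0, h => (hG.comm 0 i h hi).symm
  | k + 1, h => by
    have h1 := (hG.comm (k + 1) i h hi).symm
    exact ((h1.mul_right (hG.commute_jucysMurphy_of_lt hi (by omega))).mul_right h1).smul_right _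

theorem commute_jucysMurphy_of_gt (hG : IsCycloFamily q n G) {i : ℕ} (hi : 1 ≤ i) :
    ∀ {k : ℕ}, i < k → k < n → Commute (G i) (jucysMurphy q G k)
  | 0, h, _ => by omega
  | k + 1, h, hk => by
    rcases Nat.lt_succ_iff_lt_or_eq.mp h with h | rfl
    · have h1 := hG.comm i (k + 1) (by omega) hk
      exact ((h1.mul_right (hG.commute_jucysMurphy_of_gt hi h (by omega))).mul_right
        h1).smul_right _
    · obtain ⟨m, rfl⟩ := Nat.exists_eq_add_of_le' hi
      have h1 := (hG.commute_jucysMurphy_of_lt hk (k := m) (by omega)).eq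
      have h2 := hG.braid (m + 1) hi hk
      simp only [jucysMurphy, mul_smul_comm, smul_mul_assoc]
      refine (Commute.smul_right ?_ _).smul_right _
      set T := G (m + 1)
      set U := G (m + 1 + 1)
      set J := jucysMurphy q G m
      calc T * (U * (T * J * T) * U) = (T * U * T) * J * T * U := by noncomm_ring
        _ = U * T * (U * J) * T * U := by rw [h2]; noncomm_ring
        _ = U * T * J * (U * T * U) := by rw [h1]; noncomm_ring
        _ = U * (T * J * T) * U * T := by rw [← h2]; noncomm_ring

theorem commute_zero_jucysMurphy (hG : IsCycloFamily q n G) :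
    ∀ {k : ℕ}, k < n → Commute (G 0) (jucysMurphy q G k)
  | 0, _ => Commute.refl _
  | 1, h => by
    refine Commute.smul_right ?_ _
    have := hG.braid_zero h
    simpa only [Commute, SemiconjBy, jucysMurphy, mul_assoc] using this
  | k + 2, h => by
    have h1 := hG.comm 0 (k + 2) (by omega) h
    exact ((h1.mul_right (hG.commute_zero_jucysMurphy (by omega))).mul_right h1).smul_right _

theorem commute_jucysMurphy_of_le (hG : IsCycloFamily q n G) {k : ℕ} (hk : k < n) :
    ∀ {j : ℕ}, j ≤ k → Commute (jucysMurphy q G j) (jucysMurphy q G k)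
  | 0, _ => hG.commute_zero_jucysMurphy hk
  | j + 1, h => by
    rcases h.lt_or_eq with h' | rfl
    · have h1 := hG.commute_jucysMurphy_of_gt (i := j + 1) (by omega) h' hk
      exact ((h1.mul_left (hG.commute_jucysMurphy_of_le hk (by omega))).mul_left h1).smul_left _
    · exact Commute.refl _

theorem commute_jucysMurphy (hG : IsCycloFamily q n G) {j k : ℕ} (hj : j < n) (hk : k < n) :
    Commute (jucysMurphy q G j) (jucysMurphy q G k) := by
  rcases le_total j k with h | h
  · exact hG.commute_jucysMurphy_of_le hk h
  · exact (hG.commute_jucysMurphy_of_le hj h).symm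

theorem sub_mul_self (hG : IsCycloFamily q n G) {k : ℕ} (hk : k + 1 < n) :
    (G (k + 1) - (q - 1) • (1 : A)) * G (k + 1) = q • 1 := by
  rw [sub_mul, hG.quad _ (by omega) hk]; simp

theorem mul_sub_self (hG : IsCycloFamily q n G) {k : ℕ} (hk : k + 1 < n) :
    G (k + 1) * (G (k + 1) - (q - 1) • (1 : A)) = q • 1 := by
  rw [mul_sub, hG.quad _ (by omega) hk]; simp

theorem mul_jucysMurphy (hG : IsCycloFamily q n G) (hq : q ≠ 0) {k : ℕ} (hk : k + 1 < n) :
    G (k + 1) * jucysMurphy q G k =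
      jucysMurphy q G (k + 1) * (G (k + 1) - (q - 1) • (1 : A)) := by
  rw [jucysMurphy, smul_mul_assoc, mul_assoc _ (G (k + 1)), hG.mul_sub_self hk]
  simp [smul_smul, hq]

theorem jucysMurphy_mul (hG : IsCycloFamily q n G) (hq : q ≠ 0) {k : ℕ} (hk : k + 1 < n) :
    jucysMurphy q G k * G (k + 1) =
      (G (k + 1) - (q - 1) • (1 : A)) * jucysMurphy q G (k + 1) := by
  rw [jucysMurphy, mul_smul_comm, ← mul_assoc, ← mul_assoc, hG.sub_mul_self hk]
  simp [smul_smul, hq]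

theorem exists_isSupport (hG : IsCycloFamily q n G) (hq : q ≠ 0) :
    ∀ {k : ℕ}, k < n → ∃ p, IsSupport (jucysMurphy q G k) p
  | 0, h => by
    have := hG.idem h
    exact ⟨G 0, G 0, this, this, this, this, this, this⟩
  | k + 1, h => by
    obtain ⟨p, hp⟩ := hG.exists_isSupport hq (k := k) (by omega)
    exact hp.exists_of_intertwine hq (sub_add_cancel _ _).symm (hG.sub_mul_self h)
      (hG.mul_jucysMurphy hq h) (hG.jucysMurphy_mul hq h) (hG.commute_jucysMurphy (by omega) h)

theorem isSupport (hG : IsCycloFamily q n G) (hq : q ≠ 0) {k : ℕ} (hk : k < n) :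
    IsSupport (jucysMurphy q G k) (1 - kerProj q G k) := by
  have h := hG.exists_isSupport hq hk
  rw [kerProj, dif_pos h, sub_sub_cancel]
  exact h.choose_spec

theorem kerProj_eq (hG : IsCycloFamily q n G) (hq : q ≠ 0) {k : ℕ} (hk : k < n) {p : A}
    (hp : IsSupport (jucysMurphy q G k) p) : kerProj q G k = 1 - p := by
  rw [← (hG.isSupport hq hk).unique hp, sub_sub_cancel]

theorem kerProj_zero (hG : IsCycloFamily q n G) (hq : q ≠ 0) (hn : 0 < n) :
    kerProj q G 0 = 1 - G 0 :=
  have h := hG.idem hn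
  hG.kerProj_eq hq hn ⟨G 0, h, h, h, h, h, h⟩

theorem commute_kerProj_of_commute (hG : IsCycloFamily q n G) (hq : q ≠ 0) {k : ℕ} (hk : k < n)
    {w : A} (h : Commute w (jucysMurphy q G k)) : Commute w (kerProj q G k) := by
  have := (Commute.one_right w).sub_right ((hG.isSupport hq hk).commute h)
  rwa [sub_sub_cancel] at this

theorem commute_kerProj (hG : IsCycloFamily q n G) (hq : q ≠ 0) {j k : ℕ} (hj : j < n)
    (hk : k < n) : Commute (kerProj q G j) (kerProj q G k) :=
  hG.commute_kerProj_of_commute hq hk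
    (hG.commute_kerProj_of_commute hq hj (hG.commute_jucysMurphy hk hj)).symm

theorem kerProj_mul_self (hG : IsCycloFamily q n G) (hq : q ≠ 0) {k : ℕ} (hk : k < n) :
    kerProj q G k * kerProj q G k = kerProj q G k := by
  have h := (hG.isSupport hq hk).mul_self
  simp only [sub_mul, mul_sub, one_mul, mul_one] at h
  exact (sub_eq_zero.mp (by simpa using h)).symm

theorem jucysMurphy_mul_kerProj (hG : IsCycloFamily q n G) (hq : q ≠ 0) {k : ℕ} (hk : k < n) :
    jucysMurphy q G k * kerProj q G k = 0 := by
  obtain ⟨g, -, -, h, -⟩ := hG.isSupport hq hk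
  simpa [mul_sub] using h

theorem commute_gen_kerProj (hG : IsCycloFamily q n G) (hq : q ≠ 0) {i k : ℕ} (hi : i < n)
    (hk : k < n) (hik : k ≠ i) (hik' : k + 1 ≠ i) : Commute (G i) (kerProj q G k) := by
  refine hG.commute_kerProj_of_commute hq hk ?_
  rcases Nat.eq_zero_or_pos i with rfl | hi0
  · exact hG.commute_zero_jucysMurphy hk
  · rcases lt_or_gt_of_ne hik with h | h
    · exact hG.commute_jucysMurphy_of_lt hi (by omega)
    · exact hG.commute_jucysMurphy_of_gt hi0 h hk

theorem kerProj_mul (hG : IsCycloFamily q n G) (hq : q ≠ 0) {k : ℕ} (hk : k + 1 < n) :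
    kerProj q G k * G (k + 1) = G (k + 1) * kerProj q G (k + 1) +
      (q - 1) • (kerProj q G k * (1 - kerProj q G (k + 1))) := by
  have h := IsSupport.mul_intertwine (sub_add_cancel _ _).symm (hG.jucysMurphy_mul hq hk)
    (hG.isSupport hq (by omega)) (hG.isSupport hq hk)
  simp only [sub_mul, mul_sub, one_mul, mul_one, sub_sub_cancel] at h ⊢
  linear_combination (norm := module) (-1 : K) • h

theorem kerProj_succ_mul (hG : IsCycloFamily q n G) (hq : q ≠ 0) {k : ℕ} (hk : k + 1 < n) :
    kerProj q G (k + 1) * G (k + 1) = G (k + 1) * kerProj q G k -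
      (q - 1) • (kerProj q G k * (1 - kerProj q G (k + 1))) := by
  have h := IsSupport.mul_intertwine' (sub_add_cancel _ _).symm (hG.mul_jucysMurphy hq hk)
    (hG.commute_jucysMurphy (by omega) hk) (hG.isSupport hq (by omega)) (hG.isSupport hq hk)
  simp only [sub_mul, mul_sub, one_mul, mul_one, sub_sub_cancel] at h ⊢
  linear_combination (norm := module) (-1 : K) • h

theorem commute_kerProj_mul (hG : IsCycloFamily q n G) (hq : q ≠ 0) {k : ℕ} (hk : k + 1 < n) :
    Commute (kerProj q G k * kerProj q G (k + 1)) (G (k + 1)) := by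
  have h0 := (hG.commute_kerProj hq (show k < n by omega) hk).eq
  have h1 := hG.kerProj_mul_self hq (show k < n by omega)
  have h2 := hG.kerProj_mul_self hq hk
  have h3 : kerProj q G k * (1 - kerProj q G (k + 1)) * kerProj q G k =
      kerProj q G k * (1 - kerProj q G (k + 1)) := by
    simp only [mul_sub, sub_mul, mul_one, h1]
    rw [mul_assoc, ← h0, ← mul_assoc, h1]
  rw [commute_iff_eq, mul_assoc, hG.kerProj_succ_mul hq hk, mul_sub, mul_smul_comm, ← mul_assoc,
    ← mul_assoc, h1, hG.kerProj_mul hq hk, add_mul, smul_mul_assoc, h3, mul_assoc, ← h0]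
  simp

theorem kerProj_mul_jucysMurphy (hG : IsCycloFamily q n G) (hq : q ≠ 0) {k : ℕ} (hk : k < n) :
    kerProj q G k * jucysMurphy q G k = 0 := by
  rw [← hG.jucysMurphy_mul_kerProj hq hk]
  exact (hG.commute_kerProj_of_commute hq hk (.refl _)).symm.eq

theorem jucysMurphy_mul_twistFamily (hG : IsCycloFamily q n G) (hq : q ≠ 0) {k : ℕ}
    (hk : k + 1 < n) :
    jucysMurphy q G k * twistFamily q G (k + 1) = jucysMurphy q G k * G (k + 1) := by
  rw [twistFamily, twist, mul_add, ← mul_assoc, ← mul_assoc,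
    hG.jucysMurphy_mul_kerProj hq (by omega)]
  simp

theorem twistFamily_mul_jucysMurphy (hG : IsCycloFamily q n G) (hq : q ≠ 0) {k : ℕ}
    (hk : k + 1 < n) :
    twistFamily q G (k + 1) * jucysMurphy q G k = G (k + 1) * jucysMurphy q G k := by
  have h : Commute (kerProj q G k * kerProj q G (k + 1)) ((q - 1) • 1 - 2 * G (k + 1)) :=
    ((Commute.one_right _).smul_right _).sub_right
      ((Commute.ofNat_right _ 2).mul_right (hG.commute_kerProj_mul hq hk))
  rw [twistFamily, twist, add_mul, h.eq, (hG.commute_kerProj hq (show k < n by omega) hk).eq,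
    mul_assoc, mul_assoc, hG.kerProj_mul_jucysMurphy hq (by omega)]
  simp

theorem isCycloFamily_twistFamily (hG : IsCycloFamily q n G) (hq : q ≠ 0) :
    IsCycloFamily q n (twistFamily q G) where
  quad
    | 0, h, _ => by omega
    | i + 1, _, hi => by
      have h0 := hG.commute_kerProj hq (show i < n by omega) hi
      refine twist_mul_self (hG.quad _ (by omega) hi) ?_ (hG.commute_kerProj_mul hq hi)
      rw [h0.symm.mul_mul_mul_comm, hG.kerProj_mul_self hq (by omega), hG.kerProj_mul_self hq hi]
  braid
    | 0, h, _ => by omega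
    | i + 1, _, hi => twist_braid (hG.quad _ (by omega) (by omega)) (hG.quad _ (by omega) hi)
        (hG.braid _ (by omega) hi) (hG.kerProj_mul_self hq (by omega))
        (hG.kerProj_mul_self hq (by omega)) (hG.kerProj_mul_self hq hi)
        (hG.commute_kerProj hq (by omega) (by omega)) (hG.commute_kerProj hq (by omega) hi)
        (hG.commute_kerProj hq (by omega) hi) (hG.kerProj_mul hq (by omega))
        (hG.kerProj_succ_mul hq (by omega))
        (hG.commute_gen_kerProj hq (by omega) hi (by omega) (by omega)).symm
        (hG.kerProj_mul hq hi) (hG.kerProj_succ_mul hq hi)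
        (hG.commute_gen_kerProj hq hi (by omega) (by omega) (by omega)).symm
  comm
    | _, 0, h, _ => by omega
    | 0, j + 1, h, hj => Commute.twist_right
        ((hG.commute_gen_kerProj hq (by omega) (by omega) (by omega) (by omega)).mul_right
          (hG.commute_gen_kerProj hq (by omega) hj (by omega) (by omega))) (hG.comm 0 _ h hj)
    | i + 1, j + 1, h, hj => by
      have hi : i + 1 < n := by omega
      refine Commute.twist_right (.mul_right ?_ ?_) ?_ <;>
        refine (Commute.twist_right (.mul_right ?_ ?_) ?_).symm
      all_goals first
        | exact hG.commute_kerProj hq (by omega) (by omega)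
        | exact (hG.comm (i + 1) (j + 1) h hj).symm
        | exact hG.commute_gen_kerProj hq (by omega) (by omega) (by omega) (by omega)
        | exact (hG.commute_gen_kerProj hq (by omega) (by omega) (by omega) (by omega)).symm
  braid_zero hn := by
    have h1 : G 0 * twistFamily q G 1 = G 0 * G 1 := hG.jucysMurphy_mul_twistFamily hq hn
    have h2 : twistFamily q G 1 * G 0 = G 1 * G 0 := hG.twistFamily_mul_jucysMurphy hq hn
    change G 0 * twistFamily q G 1 * G 0 * twistFamily q G 1 =
      twistFamily q G 1 * G 0 * twistFamily q G 1 * G 0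
    rw [h1, h2, mul_assoc _ (twistFamily q G 1), h2, mul_assoc _ (G 0), h1, ← mul_assoc,
      ← mul_assoc, hG.braid_zero hn]
  idem := hG.idem

theorem map_jucysMurphy (hG : IsCycloFamily q n G) (hq : q ≠ 0) (φ : A →ₐ[K] A)
    (hφ : ∀ k < n, φ (G k) = twistFamily q G k) :
    ∀ {k : ℕ}, k < n → φ (jucysMurphy q G k) = jucysMurphy q G k
  | 0, h => hφ 0 h
  | k + 1, h => by
    rw [jucysMurphy, map_smul, map_mul, map_mul, hφ _ h, hG.map_jucysMurphy hq φ hφ (by omega),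
      hG.twistFamily_mul_jucysMurphy hq h, mul_assoc, hG.jucysMurphy_mul_twistFamily hq h,
      mul_assoc]

theorem map_kerProj (hG : IsCycloFamily q n G) (hq : q ≠ 0) (φ : A →ₐ[K] A)
    (hφ : ∀ k < n, φ (G k) = twistFamily q G k) {k : ℕ} (hk : k < n) :
    φ (kerProj q G k) = kerProj q G k := by
  have h := (hG.isSupport hq hk).map φ
  rw [hG.map_jucysMurphy hq φ hφ hk] at h
  have h' := hG.kerProj_eq hq hk h
  rw [map_sub, map_one, sub_sub_cancel] at h'
  exact h'.symm

theorem map_twistFamily (hG : IsCycloFamily q n G) (hq : q ≠ 0) (φ : A →ₐ[K] A)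
    (hφ : ∀ k < n, φ (G k) = twistFamily q G k) :
    ∀ {k : ℕ}, k < n → φ (twistFamily q G k) = G k
  | 0, h => hφ 0 h
  | k + 1, h => by
    have h0 := hG.commute_kerProj hq (show k < n by omega) h
    rw [twistFamily, map_twist, map_mul, hG.map_kerProj hq φ hφ (by omega),
      hG.map_kerProj hq φ hφ h, hφ _ h, twistFamily, twist_twist]
    rw [h0.symm.mul_mul_mul_comm, hG.kerProj_mul_self hq (by omega), hG.kerProj_mul_self hq h]

theorem kerProj_zero_mul_kerProj_one (hG : IsCycloFamily q n G) (hq : q ≠ 0) (hn : 1 < n) :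
    kerProj q G 0 * kerProj q G 1 = (1 - G 0) * (1 - q⁻¹ • (G 1 * G 0 * G 1)) := by
  have hX : G 0 = 1 - kerProj q G 0 := by rw [hG.kerProj_zero hq (by omega), sub_sub_cancel]
  have hu := hG.kerProj_mul_self hq (show 0 < n by omega)
  have huv := (hG.commute_kerProj hq hn (show 0 < n by omega)).eq
  have huT := hG.kerProj_mul hq hn
  have hvT := hG.kerProj_succ_mul hq hn
  have hT := hG.quad 1 le_rfl hn
  rw [zero_add] at huT hvT
  simp only [hX, sub_sub_cancel]
  generalize kerProj q G 0 = u at *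
  generalize kerProj q G 1 = v at *
  generalize G 1 = T at *
  have hu' : u * (1 - v) * (1 - u) = 0 := by
    simp only [mul_sub, sub_mul, mul_one, mul_assoc, huv]
    simp [← mul_assoc, hu]
  have h : u * T * (1 - u) * T = q • (u * (1 - v)) := by
    have h1 : u * T * (1 - u) = T * v * (1 - u) := by
      rw [huT, add_mul, smul_mul_assoc, hu', smul_zero, add_zero]
    have h2 : (1 - u) * (v * T) = (1 - u) * T * u := by
      rw [hvT, mul_sub, mul_smul_comm, ← mul_assoc (1 - u) u, sub_mul 1 u u, hu]
      simp [mul_assoc]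
    have h3 : (1 - u) * v = v * (1 - u) := by
      rw [sub_mul, mul_sub, one_mul, mul_one, huv]
    have h4 : (1 - u) * T * u = (T - (q - 1) • 1) * (u * (1 - v)) := by
      have hu₁ : u * v * u = u * v := by rw [mul_assoc, huv, ← mul_assoc, hu]
      have hu₂ : T * v * u = T * u * v := by rw [mul_assoc, huv, mul_assoc]
      simp only [sub_mul, mul_sub, mul_one, huT, one_mul, add_mul, smul_mul_assoc, hu, hu₁, hu₂,
        ← mul_assoc]
      module
    have hTT : T * (T - (q - 1) • (1 : A)) = q • 1 := by
      rw [mul_sub, hT]; simp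
    rw [h1, mul_assoc T, ← h3, mul_assoc, mul_assoc (1 - u), h2, h4, ← mul_assoc, hTT,
      smul_one_mul]
  rw [mul_sub, mul_smul_comm, ← mul_assoc, ← mul_assoc, h, smul_smul, inv_mul_cancel₀ hq, one_smul]
  simp [mul_sub]

end IsCycloFamily

end JucysMurphy

section CycloHecke

variable {K A : Type} [Field K] [Ring A] [Algebra K A] {q : K} {n : ℕ}

/-- The generators of `H_n(1,0)` as a sequence, extended by zero. -/
def cycloGen (q : K) (n : ℕ) (k : ℕ) : CycloHecke K q n :=
  if h : k < n then CycloHecke.gen ⟨k, h⟩ else 0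

theorem cycloGen_of_lt {k : ℕ} (h : k < n) : cycloGen q n k = CycloHecke.gen ⟨k, h⟩ := dif_pos h

theorem isCycloFamily_cycloGen (q : K) (n : ℕ) : IsCycloFamily q n (cycloGen q n) where
  quad i h hi := by
    rw [cycloGen_of_lt hi]
    simpa [CycloHecke.gen] using RingQuot.mkAlgHom_rel K (CycloRel.quad (q := q) ⟨i, hi⟩ h)
  braid i h hi := by
    rw [cycloGen_of_lt hi, cycloGen_of_lt (show i < n by omega)]
    simpa [CycloHecke.gen] using RingQuot.mkAlgHom_rel K
      (CycloRel.braid (q := q) ⟨i, by omega⟩ ⟨i + 1, hi⟩ h rfl)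
  comm i j h hj := by
    rw [cycloGen_of_lt hj, cycloGen_of_lt (show i < n by omega)]
    rcases Nat.eq_zero_or_pos i with rfl | hi
    · simpa [CycloHecke.gen, commute_iff_eq] using RingQuot.mkAlgHom_rel K
        (CycloRel.Xcomm (q := q) ⟨0, by omega⟩ ⟨j, hj⟩ rfl (by simpa using h))
    · simpa [CycloHecke.gen, commute_iff_eq] using RingQuot.mkAlgHom_rel K
        (CycloRel.comm (q := q) ⟨i, by omega⟩ ⟨j, hj⟩ hi (by simp; omega) (.inl h))
  braid_zero h := by
    rw [cycloGen_of_lt h, cycloGen_of_lt (show 0 < n by omega)]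
    simpa [CycloHecke.gen] using RingQuot.mkAlgHom_rel K
      (CycloRel.Xbraid (q := q) ⟨0, by omega⟩ ⟨1, h⟩ rfl rfl)
  idem h := by
    rw [cycloGen_of_lt h]
    simpa [CycloHecke.gen] using RingQuot.mkAlgHom_rel K (CycloRel.Xidem (q := q) ⟨0, h⟩ rfl)

/-- The algebra morphism out of `H_n(1,0)` given by a family satisfying its relations. -/
def cycloLift {G : ℕ → A} (hG : IsCycloFamily q n G) : CycloHecke K q n →ₐ[K] A :=
  RingQuot.liftAlgHom K ⟨FreeAlgebra.lift K fun i : Fin n => G i, fun {x y} h => by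
    induction h with
    | quad i hi => simpa using hG.quad i hi i.2
    | braid i j hi hij => simpa [← hij] using hG.braid i hi (hij ▸ j.2)
    | comm i j hi hj hij =>
      rcases hij with h | h
      · simpa using (hG.comm i j h j.2).eq
      · simpa using (hG.comm j i h i.2).symm.eq
    | Xcomm x i hx hi => simpa [hx] using (hG.comm 0 i hi i.2).eq
    | Xbraid x t hx ht => simpa [hx, ht] using hG.braid_zero (ht ▸ t.2)
    | Xidem x hx => simpa [hx] using hG.idem (hx ▸ x.2)⟩

theorem cycloLift_cycloGen {G : ℕ → A} (hG : IsCycloFamily q n G) {k : ℕ} (hk : k < n) :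
    cycloLift hG (cycloGen q n k) = G k := by
  simp [cycloLift, CycloHecke.gen, cycloGen_of_lt hk]

theorem CycloHecke.algHom_ext_s10 {B : Type*} [Semiring B] [Algebra K B]
    {φ ψ : CycloHecke K q n →ₐ[K] B}
    (h : ∀ k < n, φ (cycloGen q n k) = ψ (cycloGen q n k)) : φ = ψ := by
  apply RingQuot.ringQuot_ext'
  ext i
  simpa [cycloGen_of_lt i.2, CycloHecke.gen] using h i i.2

/-- The involution of `H_n(1,0)` fixing `X` and transposing the second component of each
bipartition. -/
def twistEquiv (n : ℕ) (hq : q ≠ 0) : CycloHecke K q n ≃ₐ[K] CycloHecke K q n :=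
  have hG : IsCycloFamily q n (cycloGen q n) := isCycloFamily_cycloGen q n
  let φ := cycloLift (hG.isCycloFamily_twistFamily hq)
  have h : φ.comp φ = AlgHom.id K _ := CycloHecke.algHom_ext_s10 fun k hk => by
    simp only [AlgHom.comp_apply, φ]
    rw [cycloLift_cycloGen _ hk]
    exact hG.map_twistFamily hq _ (fun k hk => cycloLift_cycloGen _ hk) hk
  AlgEquiv.ofAlgHom φ φ h h

theorem isCycloFamily_flip {G : ℕ → A} (hG : IsCycloFamily q n G) :
    IsCycloFamily q n fun k => (if k = 0 then (1 : A) else (q - 1) • 1) - G k where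
  quad i h hi := by
    have := hG.quad i h hi
    simp only [if_neg (show i ≠ 0 by omega), sub_mul, mul_sub, smul_mul_assoc, mul_smul_comm,
      one_mul, mul_one, this]
    module
  braid i h hi := by
    have e1 := hG.quad i h (by omega)
    have e2 := hG.quad (i + 1) (by omega) hi
    have e3 := hG.braid i h hi
    simp only [mul_assoc] at e3
    simp only [if_neg (show i ≠ 0 by omega), if_neg (show i + 1 ≠ 0 by omega), sub_mul, mul_sub,
      smul_mul_assoc, mul_smul_comm, one_mul, mul_one, mul_assoc, e1, e2, e3]
    module
  comm i j h hj := by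
    refine Commute.sub_left ?_ (Commute.sub_right ?_ (hG.comm i j h hj))
    all_goals split_ifs
    all_goals simp [Commute.smul_left, Commute.smul_right]
  braid_zero h := by
    have e1 := hG.quad 1 le_rfl h
    have e2 := hG.idem (by omega)
    have e3 := hG.braid_zero h
    simp only [mul_assoc] at e3
    simp only [if_pos, if_neg one_ne_zero, sub_mul, mul_sub, smul_mul_assoc, mul_smul_comm,
      one_mul, mul_one, mul_assoc, e1, e2, e3, mul_add, add_mul]
    module
  idem h := by
    simp [sub_mul, mul_sub, hG.idem h]

/-- The involution `X ↦ 1 - X`, `T_i ↦ q - 1 - T_i` of `H_n(1,0)`. -/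
def flipEquiv (q : K) (n : ℕ) : CycloHecke K q n ≃ₐ[K] CycloHecke K q n :=
  let φ := cycloLift (isCycloFamily_flip (isCycloFamily_cycloGen q n))
  have h : φ.comp φ = AlgHom.id K _ := CycloHecke.algHom_ext_s10 fun k hk => by
    simp only [AlgHom.comp_apply, φ]
    rw [cycloLift_cycloGen _ hk]
    rw [map_sub, cycloLift_cycloGen _ hk]
    split_ifs <;> simp
  AlgEquiv.ofAlgHom φ φ h h

/-- Solomon's relations for a sequence `G 0, …, G (n-1)`. -/
structure IsSolomonFamily {K A : Type*} [Field K] [Ring A] [Algebra K A] (q : K) (n : ℕ)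
    (G : ℕ → A) : Prop where
  quad_zero : 0 < n → G 0 * G 0 = (q - 2) • G 0 + (q - 1) • 1
  quad : ∀ i, 1 ≤ i → i < n → G i * G i = (q - 1) • G i + q • 1
  braid : ∀ i, 1 ≤ i → i + 1 < n → G i * G (i + 1) * G i = G (i + 1) * G i * G (i + 1)
  comm : ∀ i j, i + 2 ≤ j → j < n → Commute (G i) (G j)
  rel_left : 1 < n → G 0 * G 1 * G 0 * G 1 =
    (q - 1) • (G 1 * G 0 * G 1 + G 1 * G 0) - G 0 * G 1 * G 0
  rel_right : 1 < n → G 1 * G 0 * G 1 * G 0 =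
    (q - 1) • (G 1 * G 0 * G 1 + G 0 * G 1) - G 0 * G 1 * G 0

/-- The generators of the mirabolic Hecke algebra as a sequence, extended by zero. -/
def mirabolicGen (q : K) (n : ℕ) (k : ℕ) : MirabolicHecke K q n :=
  if h : k < n then MirabolicHecke.T ⟨k, h⟩ else 0

theorem mirabolicGen_of_lt {k : ℕ} (h : k < n) :
    mirabolicGen q n k = MirabolicHecke.T ⟨k, h⟩ := dif_pos h

theorem isSolomonFamily_mirabolicGen : IsSolomonFamily q n (mirabolicGen q n) where
  quad_zero h := by
    rw [mirabolicGen_of_lt h]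
    simpa [MirabolicHecke.T] using RingQuot.mkAlgHom_rel K (SolomonRel.quad0 (q := q) ⟨0, h⟩ rfl)
  quad i h hi := by
    rw [mirabolicGen_of_lt hi]
    simpa [MirabolicHecke.T] using RingQuot.mkAlgHom_rel K (SolomonRel.quad (q := q) ⟨i, hi⟩ h)
  braid i h hi := by
    rw [mirabolicGen_of_lt hi, mirabolicGen_of_lt (show i < n by omega)]
    simpa [MirabolicHecke.T] using RingQuot.mkAlgHom_rel K
      (SolomonRel.braid (q := q) ⟨i, by omega⟩ ⟨i + 1, hi⟩ h rfl)
  comm i j h hj := by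
    rw [mirabolicGen_of_lt hj, mirabolicGen_of_lt (show i < n by omega)]
    simpa [MirabolicHecke.T, commute_iff_eq] using RingQuot.mkAlgHom_rel K
      (SolomonRel.comm (q := q) ⟨i, by omega⟩ ⟨j, hj⟩ (.inl h))
  rel_left h := by
    rw [mirabolicGen_of_lt h, mirabolicGen_of_lt (show 0 < n by omega)]
    simpa [MirabolicHecke.T] using RingQuot.mkAlgHom_rel K
      (SolomonRel.rel4 (q := q) ⟨0, by omega⟩ ⟨1, h⟩ rfl rfl)
  rel_right h := by
    rw [mirabolicGen_of_lt h, mirabolicGen_of_lt (show 0 < n by omega)]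
    simpa [MirabolicHecke.T] using RingQuot.mkAlgHom_rel K
      (SolomonRel.rel5 (q := q) ⟨0, by omega⟩ ⟨1, h⟩ rfl rfl)

/-- The algebra morphism out of the mirabolic Hecke algebra given by a family satisfying its
relations. -/
def mirabolicLift {G : ℕ → A} (hG : IsSolomonFamily q n G) : MirabolicHecke K q n →ₐ[K] A :=
  RingQuot.liftAlgHom K ⟨FreeAlgebra.lift K fun i : Fin n => G i, fun {x y} h => by
    induction h with
    | quad0 i hi => simpa [hi] using hG.quad_zero (hi ▸ i.2)
    | quad i hi => simpa using hG.quad i hi i.2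
    | braid i j hi hij => simpa [← hij] using hG.braid i hi (hij ▸ j.2)
    | comm i j hij =>
      rcases hij with h | h
      · simpa using (hG.comm i j h j.2).eq
      · simpa using (hG.comm j i h i.2).symm.eq
    | rel4 i j hi hj => simpa [hi, hj] using hG.rel_left (hj ▸ j.2)
    | rel5 i j hi hj => simpa [hi, hj] using hG.rel_right (hj ▸ j.2)⟩

theorem mirabolicLift_mirabolicGen {G : ℕ → A} (hG : IsSolomonFamily q n G) {k : ℕ} (hk : k < n) :
    mirabolicLift hG (mirabolicGen q n k) = G k := by
  simp [mirabolicLift, MirabolicHecke.T, mirabolicGen_of_lt hk]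

theorem MirabolicHecke.algHom_ext_s10 {B : Type*} [Semiring B] [Algebra K B]
    {φ ψ : MirabolicHecke K q n →ₐ[K] B}
    (h : ∀ k < n, φ (mirabolicGen q n k) = ψ (mirabolicGen q n k)) : φ = ψ := by
  apply RingQuot.ringQuot_ext'
  ext i
  simpa [mirabolicGen_of_lt i.2, MirabolicHecke.T] using h i i.2

end CycloHecke

section Quotients

theorem nonempty_ringQuot_algEquiv {K A B : Type*} [CommSemiring K] [Semiring A] [Semiring B]
    [Algebra K A] [Algebra K B] (e : A ≃ₐ[K] B) {y : A} {z : B} (h : e y = z) :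
    Nonempty (RingQuot (fun a b : A => a = y ∧ b = 0) ≃ₐ[K]
      RingQuot (fun a b : B => a = z ∧ b = 0)) := by
  subst h
  let φ : RingQuot (fun a b : A => a = y ∧ b = 0) →ₐ[K]
      RingQuot (fun a b : B => a = e y ∧ b = 0) :=
    RingQuot.liftAlgHom K ⟨(RingQuot.mkAlgHom K _).comp e.toAlgHom, by
      rintro _ _ ⟨rfl, rfl⟩
      simpa using RingQuot.mkAlgHom_rel K (s := fun a b : B => a = e _ ∧ b = 0) ⟨rfl, rfl⟩⟩
  let ψ : RingQuot (fun a b : B => a = e y ∧ b = 0) →ₐ[K]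
      RingQuot (fun a b : A => a = y ∧ b = 0) :=
    RingQuot.liftAlgHom K ⟨(RingQuot.mkAlgHom K _).comp e.symm.toAlgHom, by
      rintro _ _ ⟨rfl, rfl⟩
      simpa using RingQuot.mkAlgHom_rel K (s := fun a b : A => a = y ∧ b = 0) ⟨rfl, rfl⟩⟩
  exact ⟨AlgEquiv.ofAlgHom φ ψ
    (RingQuot.ringQuot_ext' _ _ _ (by ext; simp [φ, ψ]))
    (RingQuot.ringQuot_ext' _ _ _ (by ext; simp [φ, ψ]))⟩

variable {K A : Type*} [Field K] [Ring A] [Algebra K A] {q : K} {n : ℕ} {G : ℕ → A}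

/-- The multiple `(q+1) y_(∅,2)`, as an expression in `X` and `T_1`. -/
def emptyTwo (X T : A) : A :=
  1 - X + T - X * T - T * X + X * T * X - T * X * T + X * T * X * T

/-- The multiple `(q+1) y_(∅,11)`, as an expression in `X` and `T_1`. -/
def emptyEleven (q : K) (X T : A) : A :=
  q • 1 - q • X - T + X * T + T * X - X * T * X - q⁻¹ • (T * X * T) + q⁻¹ • (X * T * X * T)

namespace IsCycloFamily

theorem kerProj_mul_one_add (hG : IsCycloFamily q n G) (hq : q ≠ 0) (hn : 1 < n) :
    kerProj q G 0 * kerProj q G 1 * (1 + G 1) = emptyTwo (G 0) (G 1) := by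
  have hT := hG.quad 1 le_rfl hn
  rw [hG.kerProj_zero_mul_kerProj_one hq hn, emptyTwo]
  simp only [sub_mul, mul_sub, mul_add, smul_mul_assoc, mul_smul_comm, mul_assoc, one_mul,
    mul_one, hT]
  match_scalars <;> field_simp <;> ring

theorem kerProj_mul_smul_one_sub (hG : IsCycloFamily q n G) (hq : q ≠ 0) (hn : 1 < n) :
    kerProj q G 0 * kerProj q G 1 * (q • 1 - G 1) = emptyEleven q (G 0) (G 1) := by
  have hT := hG.quad 1 le_rfl hn
  rw [hG.kerProj_zero_mul_kerProj_one hq hn, emptyEleven]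
  simp only [sub_mul, mul_sub, mul_add, smul_mul_assoc, mul_smul_comm, mul_assoc, one_mul,
    mul_one, hT]
  match_scalars <;> field_simp <;> ring

theorem map_emptyTwo (hG : IsCycloFamily q n G) (hq : q ≠ 0) (hn : 1 < n) (φ : A →ₐ[K] A)
    (hφ : ∀ k < n, φ (G k) = twistFamily q G k) :
    φ (emptyTwo (G 0) (G 1)) = emptyEleven q (G 0) (G 1) := by
  have h0 : 0 < n := by omega
  have h : kerProj q G 0 * kerProj q G 1 * (kerProj q G 0 * kerProj q G 1) =
      kerProj q G 0 * kerProj q G 1 := by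
    rw [(hG.commute_kerProj hq hn h0).mul_mul_mul_comm, hG.kerProj_mul_self hq h0,
      hG.kerProj_mul_self hq hn]
  rw [← hG.kerProj_mul_one_add hq hn, ← hG.kerProj_mul_smul_one_sub hq hn, map_mul, map_mul,
    hG.map_kerProj hq φ hφ h0, hG.map_kerProj hq φ hφ hn, map_add, map_one, hφ 1 hn, twistFamily,
    twist, zero_add]
  rw [mul_add, mul_add, ← mul_assoc, h, ← mul_add, ← mul_add, two_mul]
  congr 1
  module

theorem emptyTwo_flip (hG : IsCycloFamily q n G) (hn : 1 < n) :
    emptyTwo (1 - G 0) ((q - 1) • 1 - G 1) =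
      G 1 * G 0 * G 1 * G 0 - q • (G 0 * G 1 * G 0) := by
  have hT := hG.quad 1 le_rfl hn
  have hX := hG.idem (by omega)
  have h := hG.braid_zero hn
  simp only [mul_assoc] at h
  simp only [emptyTwo, sub_mul, mul_sub, mul_add, smul_mul_assoc, mul_smul_comm,
    mul_assoc, one_mul, mul_one, hT, hX, ← h]
  module

theorem emptyEleven_flip (hG : IsCycloFamily q n G) (hq : q ≠ 0) (hn : 1 < n) :
    emptyEleven q (1 - G 0) ((q - 1) • 1 - G 1) =
      q⁻¹ • (G 1 * G 0 * G 1 * G 0 + G 0 * G 1 * G 0) := by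
  have hT := hG.quad 1 le_rfl hn
  have hX := hG.idem (by omega)
  have h := hG.braid_zero hn
  simp only [mul_assoc] at h
  simp only [emptyEleven, sub_mul, mul_sub, mul_add, smul_mul_assoc, mul_smul_comm,
    mul_assoc, one_mul, mul_one, hT, hX, ← h]
  match_scalars <;> field_simp <;> ring

theorem isSolomonFamily (hG : IsCycloFamily q n G) (h : 1 < n → emptyTwo (G 0) (G 1) = 0) :
    IsSolomonFamily q n (Function.update G 0 (q • G 0 - 1)) where
  quad_zero hn := by
    have hX := hG.idem hn
    simp only [Function.update_self, sub_mul, mul_sub, smul_mul_assoc, mul_smul_comm, one_mul,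
      mul_one, hX]
    module
  quad i h hi := by simpa [show i ≠ 0 by omega] using hG.quad i h hi
  braid i h hi := by simpa [show i ≠ 0 by omega] using hG.braid i h hi
  comm i j h hj := by
    rw [Function.update_of_ne (show j ≠ 0 by omega)]
    rcases eq_or_ne i 0 with rfl | hi
    · simpa using ((hG.comm 0 j h hj).smul_left q).sub_left (.one_left _)
    · simpa [hi] using hG.comm i j h hj
  rel_left hn := by
    have hT := hG.quad 1 le_rfl hn
    have hy := h hn
    simp only [Function.update_self, Function.update_of_ne one_ne_zero, sub_mul, mul_sub, mul_add,
      smul_mul_assoc, mul_smul_comm, mul_assoc, one_mul, mul_one, hT, emptyTwo] at hy ⊢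
    linear_combination (norm := module) q ^ 2 • hy
  rel_right hn := by
    have hT := hG.quad 1 le_rfl hn
    have hXT := hG.braid_zero hn
    have hy := h hn
    simp only [mul_assoc] at hXT
    simp only [Function.update_self, Function.update_of_ne one_ne_zero, sub_mul, mul_sub, add_mul,
      smul_mul_assoc, mul_smul_comm, mul_assoc, one_mul, mul_one, hT, emptyTwo,
      ← hXT] at hy ⊢
    linear_combination (norm := module) q ^ 2 • hy

end IsCycloFamily

namespace IsSolomonFamily

theorem emptyTwo_eq_zero (hG : IsSolomonFamily q n G) (hq : q ≠ 0) (hn : 1 < n) :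
    emptyTwo (q⁻¹ • (G 0 + 1)) (G 1) = 0 := by
  have hT := hG.quad 1 le_rfl hn
  have h := hG.rel_left hn
  simp only [emptyTwo, add_mul, mul_add, smul_mul_assoc, mul_smul_comm,
    mul_assoc, one_mul, mul_one, hT] at h ⊢
  rw [h]
  match_scalars <;> field_simp <;> ring

theorem isCycloFamily (hG : IsSolomonFamily q n G) (hq : q ≠ 0) :
    IsCycloFamily q n (Function.update G 0 (q⁻¹ • (G 0 + 1))) where
  quad i h hi := by simpa [show i ≠ 0 by omega] using hG.quad i h hi
  braid i h hi := by simpa [show i ≠ 0 by omega] using hG.braid i h hi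
  comm i j h hj := by
    rw [Function.update_of_ne (show j ≠ 0 by omega)]
    rcases eq_or_ne i 0 with rfl | hi
    · simpa using ((hG.comm 0 j h hj).add_left (.one_left _)).smul_left q⁻¹
    · simpa [hi] using hG.comm i j h hj
  braid_zero hn := by
    have hT := hG.quad 1 le_rfl hn
    have hl := hG.rel_left hn
    have hr := hG.rel_right hn
    simp only [mul_assoc] at hl hr
    simp only [Function.update_self, Function.update_of_ne one_ne_zero, add_mul, mul_add,
      smul_mul_assoc, mul_smul_comm, mul_assoc, one_mul, mul_one, hT, hl, hr]
    match_scalars <;> field_simp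
  idem hn := by
    have hX := hG.quad_zero hn
    simp only [Function.update_self, add_mul, mul_add, smul_mul_assoc, mul_smul_comm, one_mul,
      mul_one, hX]
    match_scalars <;> field_simp <;> ring

end IsSolomonFamily

end Quotients

section Isomorphisms

variable {K : Type} [Field K] {q : K} {n : ℕ}

theorem twistEquiv_emptyTwo (hq : q ≠ 0) (hn : 1 < n) :
    twistEquiv n hq (emptyTwo (cycloGen q n 0) (cycloGen q n 1)) =
      emptyEleven q (cycloGen q n 0) (cycloGen q n 1) :=
  (isCycloFamily_cycloGen q n).map_emptyTwo hq hn (twistEquiv n hq).toAlgHom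
    fun _ hk => cycloLift_cycloGen ((isCycloFamily_cycloGen q n).isCycloFamily_twistFamily hq) hk

theorem flipEquiv_cycloGen (q : K) {k : ℕ} (hk : k < n) :
    flipEquiv q n (cycloGen q n k) = (if k = 0 then 1 else (q - 1) • 1) - cycloGen q n k :=
  cycloLift_cycloGen _ hk

theorem nonempty_mirabolicHecke_algEquiv (hq : q ≠ 0) (hn : 1 < n) {c : K} (hc : c ≠ 0)
    {y : CycloHecke K q n} (hy : y = c • emptyTwo (cycloGen q n 0) (cycloGen q n 1)) :
    Nonempty (MirabolicHecke K q n ≃ₐ[K]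
      RingQuot (fun a b : CycloHecke K q n => a = y ∧ b = 0)) := by
  let π := RingQuot.mkAlgHom K (fun a b : CycloHecke K q n => a = y ∧ b = 0)
  have hπy : π y = 0 := by
    simpa [π] using
      RingQuot.mkAlgHom_rel K (s := fun a b : CycloHecke K q n => a = y ∧ b = 0) ⟨rfl, rfl⟩
  have hG : IsCycloFamily q n fun k => π (cycloGen q n k) :=
    (isCycloFamily_cycloGen q n).map
      (B := RingQuot fun a b : CycloHecke K q n => a = y ∧ b = 0) π
  have hπ : emptyTwo (π (cycloGen q n 0)) (π (cycloGen q n 1)) = 0 := by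
    have h := congrArg π hy
    rw [hπy, map_smul, eq_comm, smul_eq_zero_iff_right hc] at h
    simpa [emptyTwo] using h
  have hS : IsSolomonFamily q n (mirabolicGen q n) := isSolomonFamily_mirabolicGen
  let φ := mirabolicLift (hG.isSolomonFamily fun _ => hπ)
  let ψ₀ := cycloLift (hS.isCycloFamily hq)
  have h0 : ψ₀ (cycloGen q n 0) = q⁻¹ • (mirabolicGen q n 0 + 1) := by
    simp [ψ₀, cycloLift_cycloGen _ (show 0 < n by omega)]
  have hψ₀ {k : ℕ} (hk : k < n) (hk0 : k ≠ 0) : ψ₀ (cycloGen q n k) = mirabolicGen q n k := by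
    simp [ψ₀, cycloLift_cycloGen _ hk, hk0]
  have hψy : ψ₀ y = 0 := by
    have := hS.emptyTwo_eq_zero hq hn
    rw [← h0, ← hψ₀ hn one_ne_zero] at this
    rw [hy, map_smul, smul_eq_zero_iff_right hc]
    simpa [emptyTwo] using this
  let ψ : RingQuot (fun a b : CycloHecke K q n => a = y ∧ b = 0) →ₐ[K] MirabolicHecke K q n :=
    RingQuot.liftAlgHom K ⟨ψ₀, by rintro _ _ ⟨rfl, rfl⟩; simpa using hψy⟩
  have hψ (a : CycloHecke K q n) : ψ (π a) = ψ₀ a := by simp [ψ, π]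
  have hφ0 : φ (mirabolicGen q n 0) = q • π (cycloGen q n 0) - 1 := by
    simp [φ, mirabolicLift_mirabolicGen _ (show 0 < n by omega)]
  have hφ {k : ℕ} (hk : k < n) (hk0 : k ≠ 0) : φ (mirabolicGen q n k) = π (cycloGen q n k) := by
    simp [φ, mirabolicLift_mirabolicGen _ hk, hk0]
  refine ⟨AlgEquiv.ofAlgHom φ ψ (RingQuot.ringQuot_ext' _ _ _ ?_) ?_⟩
  · refine CycloHecke.algHom_ext_s10 fun k hk => ?_
    change φ (ψ (π _)) = π _
    rw [hψ]
    rcases eq_or_ne k 0 with rfl | hk0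
    · rw [h0, map_smul, map_add, map_one, hφ0]
      refine .trans ?_ (inv_smul_smul₀ hq _)
      exact congrArg _ <|
        sub_add_cancel (G := RingQuot fun a b : CycloHecke K q n => a = y ∧ b = 0) _ _
    · rw [hψ₀ hk hk0, hφ hk hk0]
  · refine MirabolicHecke.algHom_ext_s10 fun k hk => ?_
    change ψ (φ _) = _
    rcases eq_or_ne k 0 with rfl | hk0
    · rw [hφ0]
      refine (map_sub ψ _ _).trans ?_
      rw [map_one, map_smul, hψ, h0, smul_inv_smul₀ hq, add_sub_cancel_right]
      rfl
    · rw [hφ hk hk0, hψ, hψ₀ hk hk0]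
      rfl

end Isomorphisms

section Stmt10

local notation "K" => RatFunc ℂ
local notation "q" => (RatFunc.X : RatFunc ℂ)

variable (n : ℕ) (hn : 1 < n)

theorem Xg_eq_cycloGen : Xg n hn = cycloGen q n 0 := (cycloGen_of_lt _).symm

theorem T1g_eq_cycloGen : T1g n hn = cycloGen q n 1 := (cycloGen_of_lt _).symm

theorem yEmptyTwo_eq :
    yEmptyTwo n hn = (q + 1)⁻¹ • emptyTwo (cycloGen q n 0) (cycloGen q n 1) := by
  rw [← Xg_eq_cycloGen n hn, ← T1g_eq_cycloGen n hn]
  rfl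

theorem yEmptyEleven_eq :
    yEmptyEleven n hn = (q + 1)⁻¹ • emptyEleven q (cycloGen q n 0) (cycloGen q n 1) := by
  rw [← Xg_eq_cycloGen n hn, ← T1g_eq_cycloGen n hn]
  rfl

theorem twistEquiv_yEmptyTwo :
    twistEquiv n RatFunc.X_ne_zero (yEmptyTwo n hn) = yEmptyEleven n hn := by
  rw [yEmptyTwo_eq, yEmptyEleven_eq, map_smul, twistEquiv_emptyTwo _ hn]

theorem flipEquiv_yEmptyTwo : flipEquiv q n (yEmptyTwo n hn) = yElevenEmpty n hn := by
  have h0 := flipEquiv_cycloGen q (show 0 < n by omega)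
  have h1 := flipEquiv_cycloGen q hn
  have h := (isCycloFamily_cycloGen q n).emptyTwo_flip hn
  rw [if_pos rfl] at h0
  rw [if_neg one_ne_zero] at h1
  rw [← h0, ← h1] at h
  rw [yEmptyTwo_eq, yElevenEmpty, Xg_eq_cycloGen, T1g_eq_cycloGen, map_smul, ← h]
  simp [emptyTwo]

theorem flipEquiv_yEmptyEleven : flipEquiv q n (yEmptyEleven n hn) = yTwoEmpty n hn := by
  have h0 := flipEquiv_cycloGen q (show 0 < n by omega)
  have h1 := flipEquiv_cycloGen q hn
  have h := (isCycloFamily_cycloGen q n).emptyEleven_flip RatFunc.X_ne_zero hn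
  rw [if_pos rfl] at h0
  rw [if_neg one_ne_zero] at h1
  rw [← h0, ← h1] at h
  rw [yEmptyEleven_eq, yTwoEmpty, Xg_eq_cycloGen, T1g_eq_cycloGen, map_smul, mul_comm, mul_smul,
    ← h]
  simp [emptyEleven]

theorem X_add_one_ne_zero : q + 1 ≠ 0 := by
  rw [← RatFunc.algebraMap_X, ← map_one (algebraMap (Polynomial ℂ) (RatFunc ℂ)), ← map_add]
  exact RatFunc.algebraMap_ne_zero (Polynomial.X_add_C_ne_zero 1)

/-- The four quotients of `H_n(1,0)` by the two-sided ideals generated by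
`y_(∅,2), y_(∅,11), y_(2,∅), y_(11,∅)` are pairwise isomorphic `ℂ(q)`-algebras; in
particular the generic mirabolic Hecke algebra `ℛ_n ≅ H_n(1,0)/(y_(∅,2))` is isomorphic to
the generic `q`-rook algebra `𝕀_n ≅ H_n(1,0)/(y_(∅,11))`. -/
theorem cycloQuot_pairwise_iso :
    Nonempty (CycloQuot n (yEmptyTwo n hn) ≃ₐ[K] CycloQuot n (yEmptyEleven n hn)) ∧
    Nonempty (CycloQuot n (yEmptyTwo n hn) ≃ₐ[K] CycloQuot n (yTwoEmpty n hn)) ∧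
    Nonempty (CycloQuot n (yEmptyTwo n hn) ≃ₐ[K] CycloQuot n (yElevenEmpty n hn)) ∧
    Nonempty (CycloQuot n (yEmptyEleven n hn) ≃ₐ[K] CycloQuot n (yTwoEmpty n hn)) ∧
    Nonempty (CycloQuot n (yEmptyEleven n hn) ≃ₐ[K] CycloQuot n (yElevenEmpty n hn)) ∧
    Nonempty (CycloQuot n (yTwoEmpty n hn) ≃ₐ[K] CycloQuot n (yElevenEmpty n hn)) ∧
    Nonempty (MirabolicHecke K q n ≃ₐ[K] CycloQuot n (yEmptyTwo n hn)) ∧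
    Nonempty (MirabolicHecke K q n ≃ₐ[K] CycloQuot n (yEmptyEleven n hn)) := by
  obtain ⟨e₁⟩ := nonempty_ringQuot_algEquiv _ (twistEquiv_yEmptyTwo n hn)
  obtain ⟨e₂⟩ := nonempty_ringQuot_algEquiv _ (flipEquiv_yEmptyTwo n hn)
  obtain ⟨e₃⟩ := nonempty_ringQuot_algEquiv _ (flipEquiv_yEmptyEleven n hn)
  obtain ⟨e₄⟩ := nonempty_mirabolicHecke_algEquiv RatFunc.X_ne_zero hn
    (inv_ne_zero X_add_one_ne_zero) (yEmptyTwo_eq n hn)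
  exact ⟨⟨e₁⟩, ⟨e₁.trans e₃⟩, ⟨e₂⟩, ⟨e₃⟩, ⟨e₁.symm.trans e₂⟩, ⟨(e₁.trans e₃).symm.trans e₂⟩, ⟨e₄⟩,
    ⟨e₄.trans e₁⟩⟩

end Stmt10
end
end
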